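/- arXiv:1303.6796 — 5 statements merged into one kernel-verified Lean document; each statement's English description precedes it below -/
import Mathlib

section
/- Fix an integer n with 2 ≤ n ≤ N and suppose γ_{i−1} ≠ γ_i for i = 1, …, n−1. Define 2×2 matrices by C_1 = A_1 and C_{i+1} = A_{i+1} − B_i C_i⁻¹ B_i for i = 1, …, n−1. Then each C_i with 1 ≤ i ≤ n−1 is invertible, and C_n = [[(1/4)δ_{n−1} + (1/3)δ_n, −(1/4)δ_{n−1}γ_{n−1} − (1/3)δ_nγ_n], [−(1/4)δ_{n−1}γ_{n−1} − (1/3)δ_nγ_n, (1/4)δ_{n−1}γ_{n−1}² + (1/3)δ_nγ_n²]], with det C_n = (1/12) δ_{n−1} δ_n (γ_{n−1} − γ_n)². -/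
/-- The matrix `a • v vᵀ + b • w wᵀ` with `v = (1, -g)` and `w = (1, -h)`. -/
def rankOneSum (a b g h : ℝ) : Matrix (Fin 2) (Fin 2) ℝ :=
  !![a + b, -a * g - b * h; -a * g - b * h, a * g ^ 2 + b * h ^ 2]

theorem det_rankOneSum (a b g h : ℝ) :
    (rankOneSum a b g h).det = a * b * (g - h) ^ 2 := by
  rw [rankOneSum, Matrix.det_fin_two_of]
  ring

theorem isUnit_rankOneSum {a b g h : ℝ} (ha : a ≠ 0) (hb : b ≠ 0) (hgh : g ≠ h) :
    IsUnit (rankOneSum a b g h) := by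
  rw [Matrix.isUnit_iff_isUnit_det, det_rankOneSum, isUnit_iff_ne_zero]
  exact mul_ne_zero (mul_ne_zero ha hb) (pow_ne_zero _ (sub_ne_zero.2 hgh))

theorem mul_inv_rankOneSum_mul {a b g h : ℝ} (c : ℝ) (ha : a ≠ 0) (hb : b ≠ 0) (hgh : g ≠ h) :
    rankOneSum 0 c g h * (rankOneSum a b g h)⁻¹ * rankOneSum 0 c g h =
      rankOneSum 0 (c ^ 2 / b) g h := by
  have hgh' : g - h ≠ 0 := sub_ne_zero.2 hgh
  rw [Matrix.inv_def, det_rankOneSum, Ring.inverse_eq_inv']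
  simp only [rankOneSum, Matrix.adjugate_fin_two_of]
  ext i j
  fin_cases i <;> fin_cases j <;>
    simp [Matrix.mul_apply, Fin.sum_univ_two] <;> field_simp <;> ring

/-- Schur complements in the block elimination of the block
tridiagonal mass matrix. Same setup as Statements 8/9: `δ_i = X_{i+1} − X_i > 0`
for `i ≤ N`, `γ_i = (y_{i+1} − y_i)/(X_{i+1} − X_i)`, with 2×2 blocks `A_i`
(`i = 1, …, N`) and `B_i` (`i = 1, …, N−1`). Given `2 ≤ n ≤ N`, assume
`γ_{i−1} ≠ γ_i` for `i = 1, …, n−1`, and define `C_1 = A_1`,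
`C_{i+1} = A_{i+1} − B_i C_i⁻¹ B_i` for `i = 1, …, n−1`. Then each `C_i` with
`1 ≤ i ≤ n−1` is invertible, `C_n` is given by the explicit formula, and
`det C_n = (1/12) δ_{n−1} δ_n (γ_{n−1} − γ_n)²`. -/
theorem stmt7 (N : ℕ) (hN : 1 ≤ N) (X y : ℕ → ℝ)
    (δ γ : ℕ → ℝ)
    (hδ : ∀ i, δ i = X (i + 1) - X i)
    (hγ : ∀ i, γ i = (y (i + 1) - y i) / (X (i + 1) - X i))
    (hδpos : ∀ i ≤ N, 0 < δ i)
    (A B : ℕ → Matrix (Fin 2) (Fin 2) ℝ)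
    (hA : ∀ i, A i =
      !![(1/3) * δ (i - 1) + (1/3) * δ i,
         -(1/3) * δ (i - 1) * γ (i - 1) - (1/3) * δ i * γ i;
         -(1/3) * δ (i - 1) * γ (i - 1) - (1/3) * δ i * γ i,
         (1/3) * δ (i - 1) * γ (i - 1)^2 + (1/3) * δ i * γ i^2])
    (hB : ∀ i, B i =
      !![(1/6) * δ i, -(1/6) * δ i * γ i;
         -(1/6) * δ i * γ i, (1/6) * δ i * γ i^2])
    (n : ℕ) (hn2 : 2 ≤ n) (hnN : n ≤ N)
    (hγne : ∀ i, 1 ≤ i → i ≤ n - 1 → γ (i - 1) ≠ γ i)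
    (C : ℕ → Matrix (Fin 2) (Fin 2) ℝ)
    (hC1 : C 1 = A 1)
    (hCrec : ∀ i, 1 ≤ i → i ≤ n - 1 → C (i + 1) = A (i + 1) - B i * (C i)⁻¹ * B i) :
    (∀ i, 1 ≤ i → i ≤ n - 1 → IsUnit (C i)) ∧
    C n =
      !![(1/4) * δ (n - 1) + (1/3) * δ n,
         -(1/4) * δ (n - 1) * γ (n - 1) - (1/3) * δ n * γ n;
         -(1/4) * δ (n - 1) * γ (n - 1) - (1/3) * δ n * γ n,
         (1/4) * δ (n - 1) * γ (n - 1)^2 + (1/3) * δ n * γ n^2] ∧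
    (C n).det = (1/12) * δ (n - 1) * δ n * (γ (n - 1) - γ n)^2 := by
  have hA' : ∀ i, A i = rankOneSum (δ (i - 1) / 3) (δ i / 3) (γ (i - 1)) (γ i) := by
    intro i
    rw [hA, rankOneSum]
    congr! 3 <;> ring_nf
  have hB' : ∀ i g, B i = rankOneSum 0 (δ i / 6) g (γ i) := by
    intro i g
    rw [hB, rankOneSum]
    congr! 3 <;> ring_nf
  have step : ∀ i a, 1 ≤ i → i ≤ n - 1 → 0 < a →
      C i = rankOneSum a (δ i / 3) (γ (i - 1)) (γ i) →
      C (i + 1) = rankOneSum (δ i / 4) (δ (i + 1) / 3) (γ i) (γ (i + 1)) := by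
    intro i a hi hin ha hCi
    have hd : δ i ≠ 0 := (hδpos i (by omega)).ne'
    rw [hCrec i hi hin, hCi, hA', hB' i (γ (i - 1)),
      mul_inv_rankOneSum_mul _ ha.ne' (by positivity) (hγne i hi hin)]
    simp only [rankOneSum, Nat.add_sub_cancel]
    ext j k
    fin_cases j <;> fin_cases k <;> simp <;> field_simp <;> ring
  have form : ∀ i, 1 ≤ i → i ≤ n →
      ∃ a, 0 < a ∧ C i = rankOneSum a (δ i / 3) (γ (i - 1)) (γ i) := by
    intro i hi
    induction i, hi using Nat.le_induction with
    | base => exact fun _ => ⟨δ 0 / 3, by linarith [hδpos 0 (by omega)], by rw [hC1, hA']⟩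
    | succ i hi ih =>
      intro hin
      obtain ⟨a, ha, hCi⟩ := ih (by omega)
      exact ⟨δ i / 4, by linarith [hδpos i (by omega)], step i a hi (by omega) ha hCi⟩
  have hCn : C n = rankOneSum (δ (n - 1) / 4) (δ n / 3) (γ (n - 1)) (γ n) := by
    obtain ⟨a, ha, hCi⟩ := form (n - 1) (by omega) (by omega)
    have h := step (n - 1) a (by omega) le_rfl ha hCi
    rwa [Nat.sub_add_cancel (by omega)] at h
  refine ⟨fun i hi hin => ?_, ?_, ?_⟩
  · obtain ⟨a, ha, hCi⟩ := form i hi (by omega)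
    rw [hCi]
    exact isUnit_rankOneSum ha.ne' (by linarith [hδpos i (by omega)] : 0 < δ i / 3).ne'
      (hγne i hi hin)
  · rw [hCn, rankOneSum]
    congr! 3 <;> ring_nf
  · rw [hCn, det_rankOneSum]
    ring
end

section
/- The determinant of the mass matrix M_N equals det M_N = (δ_0 · δ_1² · ⋯ · δ_{N−1}² · δ_N) / (9 · 12^{N−1}) · (γ_0 − γ_1)² (γ_1 − γ_2)² ⋯ (γ_{N−1} − γ_N)². -/
/-- A square matrix indexed by `m × n` that is block triangular with respect to the first index
has determinant the product of the determinants of its diagonal blocks. -/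
theorem Matrix.BlockTriangular.det_prod {R m n : Type*} [CommRing R] [LinearOrder m] [Fintype m]
    [DecidableEq n] [Fintype n] {T : Matrix (m × n) (m × n) R}
    (hT : T.BlockTriangular Prod.fst) :
    T.det = ∏ i, (Matrix.of fun r s => T (i, r) (i, s)).det := by
  rw [hT.det_fintype]
  refine Finset.prod_congr rfl fun i _ => ?_
  let e : n ≃ {p : m × n // p.1 = i} :=
    { toFun := fun r => ⟨(i, r), rfl⟩
      invFun := fun p => p.1.2
      left_inv := fun _ => rfl
      right_inv := by rintro ⟨⟨_, _⟩, rfl⟩; rfl }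
  rw [← Matrix.det_submatrix_equiv_self e]
  rfl

/-- The block lower bidiagonal factor of the mass matrix: the diagonal block `i` has columns
`(1, -γ i)` and `(1, -γ (i + 1))`. -/
noncomputable def massFactor (N : ℕ) (γ : ℕ → ℝ) : Matrix (Fin N × Fin 2) (Fin N × Fin 2) ℝ :=
  fun p q =>
    if (p.1 : ℕ) = q.1 then ![1, -γ (p.1 + q.2)] p.2
    else if (p.1 : ℕ) = q.1 + 1 ∧ q.2 = 1 then (1 / 2) * ![1, -γ p.1] p.2
    else 0

/-- The diagonal factor of the mass matrix. -/
noncomputable def massDiag (N : ℕ) (δ : ℕ → ℝ) : Fin N × Fin 2 → ℝ :=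
  fun p => if p.2 = 1 then δ (p.1 + 1) / 3 else if (p.1 : ℕ) = 0 then δ 0 / 3 else δ p.1 / 4

theorem massFactor_det (N : ℕ) (γ : ℕ → ℝ) :
    (massFactor N γ).det = ∏ i ∈ Finset.range N, (γ i - γ (i + 1)) := by
  have hT : (massFactor N γ).transpose.BlockTriangular Prod.fst := by
    intro p q h
    have h' : (q.1 : ℕ) < p.1 := h
    simp only [Matrix.transpose_apply, massFactor]
    rw [if_neg (by lia), if_neg (by lia)]
  rw [← Matrix.det_transpose, hT.det_prod,
    ← Fin.prod_univ_eq_prod_range (fun i => γ i - γ (i + 1))]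
  refine Finset.prod_congr rfl fun i _ => ?_
  simp [Matrix.det_fin_two, massFactor]
  ring

theorem massDiag_prod (n : ℕ) (δ : ℕ → ℝ) :
    ∏ p, massDiag (n + 1) δ p =
      (δ 0 * (∏ i ∈ Finset.Ico 1 (n + 1), (δ i) ^ 2) * δ (n + 1)) / (9 * 12 ^ n) := by
  rw [Fintype.prod_prod_type]
  simp only [Fin.prod_univ_two, massDiag, zero_ne_one, if_true, if_false]
  rw [Fin.prod_univ_eq_prod_range
    (fun i => (if i = 0 then δ 0 / 3 else δ i / 4) * (δ (i + 1) / 3))]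
  induction n with
  | zero => simp; ring
  | succ n ih =>
    rw [Finset.prod_range_succ, ih, Finset.prod_Ico_succ_top (by lia : 1 ≤ n + 1),
      if_neg n.succ_ne_zero, pow_succ]
    field_simp
    ring

/-- Entries of `T * diagonal d * Tᵀ` for `T` the block bidiagonal factor. -/
theorem massFactor_mul_apply (N : ℕ) (δ γ : ℕ → ℝ) (i j : Fin N) (r s : Fin 2) :
    (massFactor N γ * Matrix.diagonal (massDiag N δ) * (massFactor N γ).transpose) (i, r) (j, s) =
      if (i : ℕ) = j then
        δ i / 3 * (![1, -γ i] r * ![1, -γ i] s) +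
          δ (i + 1) / 3 * (![1, -γ (i + 1)] r * ![1, -γ (i + 1)] s)
      else if (j : ℕ) = i + 1 then δ j / 6 * (![1, -γ j] r * ![1, -γ j] s)
      else if (i : ℕ) = j + 1 then δ i / 6 * (![1, -γ i] r * ![1, -γ i] s)
      else 0 := by
  rw [Matrix.mul_apply]
  simp only [Matrix.mul_diagonal, Matrix.transpose_apply]
  rw [Fintype.sum_prod_type]
  simp only [Fin.sum_univ_two]
  have far : ∀ (i k : Fin N) (r t : Fin 2), (i : ℕ) ≠ k → (i : ℕ) ≠ k + 1 →
      massFactor N γ (i, r) (k, t) = 0 := by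
    intro i k r t h₁ h₂
    simp [massFactor, h₁, h₂]
  have diag : ∀ (i : Fin N) (r t : Fin 2),
      massFactor N γ (i, r) (i, t) = ![1, -γ (i + t)] r := by
    intro i r t
    simp [massFactor]
  have sub₀ : ∀ (i k : Fin N) (r : Fin 2), (i : ℕ) = k + 1 →
      massFactor N γ (i, r) (k, 0) = 0 := by
    intro i k r h
    simp [massFactor, h]
  have sub₁ : ∀ (i k : Fin N) (r : Fin 2), (i : ℕ) = k + 1 →
      massFactor N γ (i, r) (k, 1) = (1 / 2) * ![1, -γ i] r := by
    intro i k r h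
    simp [massFactor, h]
  split_ifs with h₁ h₂ h₃
  · obtain rfl : i = j := Fin.ext h₁
    rcases Nat.eq_zero_or_pos (i : ℕ) with h₀ | h₀
    · rw [Finset.sum_eq_single i]
      · rw [diag, diag, diag, diag]
        simp [massDiag, h₀]
        ring
      · intro k _ hk
        have : (i : ℕ) ≠ k := fun h => hk (Fin.ext h.symm)
        rw [far i k r 0 this (by lia), far i k r 1 this (by lia)]
        ring
      · simp
    · let k : Fin N := ⟨i - 1, by lia⟩
      have hk : (i : ℕ) = k + 1 := by simp only [k]; lia
      rw [Finset.sum_eq_add i k]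
      · rw [diag, diag, diag, diag, sub₀ i k r hk, sub₁ i k r hk, sub₁ i k s hk]
        simp only [massDiag, if_neg h₀.ne', ← hk]
        simp
        ring
      · intro h
        rw [← h] at hk
        lia
      · rintro l - ⟨hl₁, hl₂⟩
        have e₁ : (i : ℕ) ≠ l := fun h => hl₁ (Fin.ext h.symm)
        have e₂ : (i : ℕ) ≠ l + 1 := fun h => hl₂ (Fin.ext (by lia))
        rw [far i l r 0 e₁ e₂, far i l r 1 e₁ e₂]
        ring
      · simp
      · simp
  · rw [Finset.sum_eq_single i]
    · rw [diag, diag, sub₀ j i s h₂, sub₁ j i s h₂]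
      simp [massDiag, h₂]
      ring
    · intro k _ hk
      have e : (i : ℕ) ≠ k := fun h => hk (Fin.ext h.symm)
      by_cases h : (i : ℕ) = k + 1
      · rw [far j k s 0 (by lia) (by lia), far j k s 1 (by lia) (by lia)]
        ring
      · rw [far i k r 0 e h, far i k r 1 e h]
        ring
    · simp
  · rw [Finset.sum_eq_single j]
    · rw [diag, diag, sub₀ i j r h₃, sub₁ i j r h₃]
      simp [massDiag, h₃]
      ring
    · intro k _ hk
      have e : (j : ℕ) ≠ k := fun h => hk (Fin.ext h.symm)
      by_cases h : (j : ℕ) = k + 1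
      · rw [far i k r 0 (by lia) (by lia), far i k r 1 (by lia) (by lia)]
        ring
      · rw [far j k s 0 e h, far j k s 1 e h]
        ring
    · simp
  · refine Finset.sum_eq_zero fun k _ => ?_
    by_cases e₁ : (i : ℕ) = k
    · rw [far j k s 0 (by lia) (by lia), far j k s 1 (by lia) (by lia)]
      ring
    · by_cases e₂ : (i : ℕ) = k + 1
      · rw [sub₀ i k r e₂]
        by_cases e₃ : (j : ℕ) = k + 1
        · lia
        · rw [far j k s 1 (by lia) e₃]
          ring
      · rw [far i k r 0 e₁ e₂, far i k r 1 e₁ e₂]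
        ring


/-- determinant of the block tridiagonal mass matrix.
Mesh points `X_0, …, X_{N+1}` and values `y_0, …, y_{N+1}` are encoded as
functions `X y : ℕ → ℝ`; `δ_i = X_{i+1} − X_i > 0` (for `i ≤ N`) and
`γ_i = (y_{i+1} − y_i)/(X_{i+1} − X_i)`. The 2N×2N mass matrix `M` is indexed
by `Fin N × Fin 2`, where the pair `(i, r)` addresses row `r` of block row
`i+1` (paper indexing `1, …, N`): diagonal blocks `A_1, …, A_N`, off-diagonal
blocks `B_1, …, B_{N−1}`. Then
`det M = δ_0 δ_1² ⋯ δ_{N−1}² δ_N / (9·12^{N−1}) · ∏_{i=0}^{N−1} (γ_i − γ_{i+1})²`. -/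
theorem stmt8 (N : ℕ) (hN : 1 ≤ N) (X y : ℕ → ℝ)
    (δ γ : ℕ → ℝ)
    (hδ : ∀ i, δ i = X (i + 1) - X i)
    (hγ : ∀ i, γ i = (y (i + 1) - y i) / (X (i + 1) - X i))
    (hδpos : ∀ i ≤ N, 0 < δ i)
    (A B : ℕ → Matrix (Fin 2) (Fin 2) ℝ)
    (hA : ∀ i, A i =
      !![(1/3) * δ (i - 1) + (1/3) * δ i,
         -(1/3) * δ (i - 1) * γ (i - 1) - (1/3) * δ i * γ i;
         -(1/3) * δ (i - 1) * γ (i - 1) - (1/3) * δ i * γ i,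
         (1/3) * δ (i - 1) * γ (i - 1)^2 + (1/3) * δ i * γ i^2])
    (hB : ∀ i, B i =
      !![(1/6) * δ i, -(1/6) * δ i * γ i;
         -(1/6) * δ i * γ i, (1/6) * δ i * γ i^2])
    (M : Matrix (Fin N × Fin 2) (Fin N × Fin 2) ℝ)
    (hM : ∀ (i j : Fin N) (r s : Fin 2),
      M (i, r) (j, s) =
        if (i : ℕ) = (j : ℕ) then A ((i : ℕ) + 1) r s
        else if (j : ℕ) = (i : ℕ) + 1 then B ((i : ℕ) + 1) r s
        else if (i : ℕ) = (j : ℕ) + 1 then B ((j : ℕ) + 1) r s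
        else 0) :
    M.det = (δ 0 * (∏ i ∈ Finset.Ico 1 N, (δ i)^2) * δ N) / (9 * 12^(N - 1))
      * ∏ i ∈ Finset.range N, (γ i - γ (i + 1))^2 := by
  have key : M = massFactor N γ * Matrix.diagonal (massDiag N δ) *
      (massFactor N γ).transpose := by
    ext ⟨i, r⟩ ⟨j, s⟩
    rw [hM, massFactor_mul_apply]
    refine if_congr Iff.rfl ?_ (ite_congr rfl (fun h => ?_) fun _ =>
      ite_congr rfl (fun h => ?_) fun _ => rfl)
    · rw [hA]
      fin_cases r <;> fin_cases s <;> simp <;> ring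
    · rw [hB, h]
      fin_cases r <;> fin_cases s <;> simp [-mul_eq_mul_right_iff] <;> ring
    · rw [hB, h]
      fin_cases r <;> fin_cases s <;> simp [-mul_eq_mul_right_iff] <;> ring
  obtain ⟨n, rfl⟩ : ∃ n, N = n + 1 := ⟨N - 1, by lia⟩
  rw [key, Matrix.det_mul, Matrix.det_mul, Matrix.det_transpose, Matrix.det_diagonal,
    massFactor_det, massDiag_prod, Finset.prod_pow (Finset.range _), Nat.add_sub_cancel]
  ring
end

section
/- The mass matrix M_N is singular (det M_N = 0) if and only if γ_{i−1} = γ_i for some i ∈ {1, …, N}. -/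
/-- A row of a tridiagonal matrix applied to a sequence that vanishes at both ends. -/
theorem sum_tridiagonal_mul {N : ℕ} (a b : ℕ → ℝ) (w : ℕ → ℝ) (h0 : w 0 = 0)
    (hN : w (N + 1) = 0) (i : Fin N) :
    ∑ j : Fin N, (if (i : ℕ) = (j : ℕ) then a ((i : ℕ) + 1)
        else if (j : ℕ) = (i : ℕ) + 1 then b ((i : ℕ) + 1)
        else if (i : ℕ) = (j : ℕ) + 1 then b ((j : ℕ) + 1)
        else 0) * w (j + 1) =
      b i * w i + a (i + 1) * w (i + 1) + b (i + 1) * w (i + 2) := by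
  obtain ⟨i, hi⟩ := i
  have hsplit : ∀ j : ℕ, (if i = j then a (i + 1)
        else if j = i + 1 then b (i + 1)
        else if i = j + 1 then b (j + 1)
        else 0) * w (j + 1) =
      (if i = j + 1 then b i * w i else 0) + (if i = j then a (i + 1) * w (i + 1) else 0)
        + (if i + 1 = j then b (i + 1) * w (i + 2) else 0) := by
    intro j
    by_cases h1 : i = j
    · subst h1; simp
    by_cases h2 : j = i + 1
    · subst h2; simp [show i ≠ i + 1 + 1 by omega]
    by_cases h3 : i = j + 1
    · subst h3; simp [show j + 1 + 1 ≠ j by omega, show j ≠ j + 1 + 1 by omega]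
    · simp [h1, h2, h3, Ne.symm h2]
  have hleft : ∑ j ∈ Finset.range N, (if i = j + 1 then b i * w i else 0) = b i * w i := by
    cases i with
    | zero => simp [h0]
    | succ k =>
      simp only [Nat.add_right_cancel_iff, Finset.sum_ite_eq, Finset.mem_range]
      exact if_pos (by omega)
  have hright : ∑ j ∈ Finset.range N, (if i + 1 = j then b (i + 1) * w (i + 2) else 0) =
      b (i + 1) * w (i + 2) := by
    rw [Finset.sum_ite_eq]
    split_ifs with h
    · rfl
    · have : i + 2 = N + 1 := by rw [Finset.mem_range] at h; omega
      rw [this, hN, mul_zero]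
  simp only [hsplit]
  rw [Fin.sum_univ_eq_sum_range (fun j => (if i = j + 1 then b i * w i else 0)
    + (if i = j then a (i + 1) * w (i + 1) else 0)
    + (if i + 1 = j then b (i + 1) * w (i + 2) else 0)) N,
    Finset.sum_add_distrib, Finset.sum_add_distrib, hleft, hright, Finset.sum_ite_eq,
    if_pos (Finset.mem_range.2 hi)]

/-- If the residuals of two transversal directions cancel, then both vanish. -/
theorem eq_zero_of_add_eq_zero_of_mul_add_eq_zero {p q c d : ℝ} (hcd : c ≠ d)
    (h : p + q = 0) (h' : c * p + d * q = 0) : p = 0 ∧ q = 0 := by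
  have hq : (d - c) * q = 0 := by linear_combination h' - c * h
  have hq0 : q = 0 := (mul_eq_zero.1 hq).resolve_left (sub_ne_zero.2 hcd.symm)
  exact ⟨by linarith, hq0⟩


/-- the block tridiagonal mass matrix (same setup as Statement 8:
`δ_i = X_{i+1} − X_i > 0` for `i ≤ N`, `γ_i = (y_{i+1} − y_i)/(X_{i+1} − X_i)`,
diagonal blocks `A_1, …, A_N` and off-diagonal blocks `B_1, …, B_{N−1}`,
encoded on the index type `Fin N × Fin 2` where `(i, r)` is row `r` of block
row `i+1`) is singular if and only if `γ_{i−1} = γ_i` for some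
`i ∈ {1, …, N}`. -/
theorem stmt9 (N : ℕ) (hN : 1 ≤ N) (X y : ℕ → ℝ)
    (δ γ : ℕ → ℝ)
    (hδ : ∀ i, δ i = X (i + 1) - X i)
    (hγ : ∀ i, γ i = (y (i + 1) - y i) / (X (i + 1) - X i))
    (hδpos : ∀ i ≤ N, 0 < δ i)
    (A B : ℕ → Matrix (Fin 2) (Fin 2) ℝ)
    (hA : ∀ i, A i =
      !![(1/3) * δ (i - 1) + (1/3) * δ i,
         -(1/3) * δ (i - 1) * γ (i - 1) - (1/3) * δ i * γ i;
         -(1/3) * δ (i - 1) * γ (i - 1) - (1/3) * δ i * γ i,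
         (1/3) * δ (i - 1) * γ (i - 1)^2 + (1/3) * δ i * γ i^2])
    (hB : ∀ i, B i =
      !![(1/6) * δ i, -(1/6) * δ i * γ i;
         -(1/6) * δ i * γ i, (1/6) * δ i * γ i^2])
    (M : Matrix (Fin N × Fin 2) (Fin N × Fin 2) ℝ)
    (hM : ∀ (i j : Fin N) (r s : Fin 2),
      M (i, r) (j, s) =
        if (i : ℕ) = (j : ℕ) then A ((i : ℕ) + 1) r s
        else if (j : ℕ) = (i : ℕ) + 1 then B ((i : ℕ) + 1) r s
        else if (i : ℕ) = (j : ℕ) + 1 then B ((j : ℕ) + 1) r s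
        else 0) :
    M.det = 0 ↔ ∃ i : ℕ, 1 ≤ i ∧ i ≤ N ∧ γ (i - 1) = γ i := by
  have hrow : ∀ w : ℕ → Fin 2 → ℝ, w 0 = 0 → w (N + 1) = 0 → ∀ (i : Fin N) (r : Fin 2),
      (M.mulVec fun p => w ((p.1 : ℕ) + 1) p.2) (i, r) =
        ∑ s, (B i r s * w i s + A (i + 1) r s * w (i + 1) s
          + B (i + 1) r s * w (i + 2) s) := by
    intro w h0 h1 i r
    simp only [Matrix.mulVec, dotProduct, Fintype.sum_prod_type_right, hM]
    refine Finset.sum_congr rfl fun s _ => ?_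
    exact sum_tridiagonal_mul (fun k => A k r s) (fun k => B k r s) (fun k => w k s)
      (by simp [h0]) (by simp [h1]) i
  rw [← Matrix.exists_mulVec_eq_zero_iff]
  constructor
  · rintro ⟨v, hv0, hv⟩
    by_contra! hne
    refine hv0 ?_
    let w : ℕ → Fin 2 → ℝ := fun k s =>
      if h : 1 ≤ k ∧ k ≤ N then v (⟨k - 1, by omega⟩, s) else 0
    have hw0 : w 0 = 0 := by ext s; simp [w]
    have hw1 : w (N + 1) = 0 := by ext s; simp [w]
    have hvw : v = fun p => w ((p.1 : ℕ) + 1) p.2 := by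
      ext ⟨i, s⟩
      simp [w, i.2]
    clear_value w
    subst hvw
    let L : ℕ → ℝ := fun k => w k 0 - γ k * w k 1
    let R : ℕ → ℝ := fun k => w (k + 1) 0 - γ k * w (k + 1) 1
    have hLR : ∀ i < N, L i + 2 * R i = 0 ∧ 2 * L (i + 1) + R (i + 1) = 0 := by
      intro i hi
      have e0 := congrFun hv (⟨i, hi⟩, 0)
      have e1 := congrFun hv (⟨i, hi⟩, 1)
      rw [hrow w hw0 hw1] at e0 e1
      simp [Fin.sum_univ_two, hA, hB] at e0 e1
      have hne' := hne (i + 1) (by omega) (by omega)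
      rw [Nat.add_sub_cancel] at hne'
      have key := eq_zero_of_add_eq_zero_of_mul_add_eq_zero hne'
        (p := δ i * (L i + 2 * R i)) (q := δ (i + 1) * (2 * L (i + 1) + R (i + 1)))
        (by simp only [L, R]; linear_combination 6 * e0)
        (by simp only [L, R]; linear_combination -6 * e1)
      exact ⟨(mul_eq_zero.1 key.1).resolve_left (hδpos i (by omega)).ne',
        (mul_eq_zero.1 key.2).resolve_left (hδpos (i + 1) (by omega)).ne'⟩
    have hR : ∀ i < N, R i = 0 := by
      intro i hi
      have h1 := (hLR i hi).1
      cases i with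
      | zero =>
        have : L 0 = 0 := by simp [L, hw0]
        linarith
      | succ k => linarith [(hLR k (by omega)).2]
    have hL : ∀ i < N, L (i + 1) = 0 := by
      intro i hi
      have h1 := (hLR i hi).2
      rcases Nat.lt_or_ge (i + 1) N with h | h
      · linarith [hR (i + 1) h]
      · have : R (i + 1) = 0 := by
          have : i + 1 = N := by omega
          simp [R, this, hw1]
        linarith
    ext ⟨i, s⟩
    have h1 := hR i i.2
    have h2 := hL i i.2
    have hne' := hne (i + 1) (by omega) (by omega)
    rw [Nat.add_sub_cancel] at hne'
    simp only [L, R] at h1 h2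
    have hb : w (i + 1) 1 = 0 := by
      have : (γ i - γ (i + 1)) * w (i + 1) 1 = 0 := by linear_combination h2 - h1
      exact (mul_eq_zero.1 this).resolve_left (sub_ne_zero.2 hne')
    have ha : w (i + 1) 0 = 0 := by rw [hb] at h1; linarith
    fin_cases s
    · exact ha
    · exact hb
  · rintro ⟨k, hk1, hkN, hk⟩
    obtain ⟨m, rfl⟩ : ∃ m, k = m + 1 := ⟨k - 1, by omega⟩
    rw [Nat.add_sub_cancel] at hk
    let w : ℕ → Fin 2 → ℝ := fun j => if j = m + 1 then ![γ m, 1] else 0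
    have hw0 : w 0 = 0 := by simp [w]
    have hw1 : w (N + 1) = 0 := if_neg (by omega)
    refine ⟨fun p => w ((p.1 : ℕ) + 1) p.2, fun h => ?_, ?_⟩
    · have := congrFun h (⟨m, by omega⟩, 1)
      simp [w] at this
    · ext ⟨i, r⟩
      rw [hrow w hw0 hw1]
      obtain ⟨i, hi⟩ := i
      by_cases h1 : i = m + 1
      · subst h1
        fin_cases r <;> simp [w, Fin.sum_univ_two, hB, ← hk] <;> ring
      by_cases h2 : i = m
      · subst h2
        fin_cases r <;> simp [w, Fin.sum_univ_two, hA, ← hk] <;> ring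
      by_cases h3 : i + 1 = m
      · subst h3
        fin_cases r <;> simp [w, Fin.sum_univ_two, hB, show i ≠ i + 1 + 1 by omega] <;> ring
      · simp [w, h1, h2, h3]
end

section
/- Let v ∈ ℝ with 0 < v < 1, and define φ : ℝ × ℝ → ℝ by φ(X, t) = 4 · arctan( v · sinh( X/√(1 − v²) ) / cosh( v·t/√(1 − v²) ) ). Then φ satisfies the Sine-Gordon equation: for all (X, t), ∂²φ/∂t²(X,t) − ∂²φ/∂X²(X,t) + sin(φ(X,t)) = 0. -/
theorem fderiv_apply_one_zero {f : ℝ × ℝ → ℝ} {X t f' : ℝ} (hf : DifferentiableAt ℝ f (X, t))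
    (h : HasDerivAt (fun x => f (x, t)) f' X) : fderiv ℝ f (X, t) (1, 0) = f' :=
  (hf.hasFDerivAt.comp_hasDerivAt X
    ((hasDerivAt_id X).prodMk (hasDerivAt_const X t))).unique h

theorem fderiv_apply_zero_one {f : ℝ × ℝ → ℝ} {X t f' : ℝ} (hf : DifferentiableAt ℝ f (X, t))
    (h : HasDerivAt (fun y => f (X, y)) f' t) : fderiv ℝ f (X, t) (0, 1) = f' :=
  (hf.hasFDerivAt.comp_hasDerivAt t
    ((hasDerivAt_const t X).prodMk (hasDerivAt_id t))).unique h

theorem sin_four_mul_arctan (u : ℝ) :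
    Real.sin (4 * Real.arctan u) = 4 * u * (1 - u ^ 2) / (1 + u ^ 2) ^ 2 := by
  have hu : 1 + u ^ 2 ≠ 0 := by positivity
  have hsin : Real.sin (Real.arctan u) = u * Real.cos (Real.arctan u) := by
    rw [Real.sin_arctan, Real.cos_arctan]; ring
  have hcos := Real.cos_sq_arctan u
  rw [show 4 * Real.arctan u = 2 * (2 * Real.arctan u) by ring, Real.sin_two_mul,
    Real.sin_two_mul, Real.cos_two_mul, hsin]
  calc _ = 4 * u * Real.cos (Real.arctan u) ^ 2 * (2 * Real.cos (Real.arctan u) ^ 2 - 1) := by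
        ring
    _ = _ := by rw [hcos]; field_simp; ring

theorem hasDerivAt_sinh_div (s x : ℝ) :
    HasDerivAt (fun y => Real.sinh (y / s)) (Real.cosh (x / s) / s) x := by
  simpa [div_eq_mul_inv] using ((hasDerivAt_id x).div_const s).sinh

theorem hasDerivAt_cosh_div (s x : ℝ) :
    HasDerivAt (fun y => Real.cosh (y / s)) (Real.sinh (x / s) / s) x := by
  simpa [div_eq_mul_inv] using ((hasDerivAt_id x).div_const s).cosh

theorem hasDerivAt_sinh_mul_div (v s x : ℝ) :
    HasDerivAt (fun y => Real.sinh (v * y / s)) (v * Real.cosh (v * x / s) / s) x := by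
  have h := (((hasDerivAt_id' x).const_mul v).div_const s).sinh
  rwa [mul_one, ← mul_div_assoc, mul_comm _ v] at h

theorem hasDerivAt_cosh_mul_div (v s x : ℝ) :
    HasDerivAt (fun y => Real.cosh (v * y / s)) (v * Real.sinh (v * x / s) / s) x := by
  have h := (((hasDerivAt_id' x).const_mul v).div_const s).cosh
  rwa [mul_one, ← mul_div_assoc, mul_comm _ v] at h

/-- the two-soliton solution
`φ(X,t) = 4 arctan(v sinh(X/√(1 − v²)) / cosh(v t/√(1 − v²)))` with `0 < v < 1`
satisfies the Sine-Gordon equation `φ_tt − φ_XX + sin φ = 0`. The argument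
order is `(X, t)`; `∂/∂X` is the directional derivative along `(1,0)` and
`∂/∂t` along `(0,1)`. -/
theorem stmt18 (v : ℝ) (hv0 : 0 < v) (hv1 : v < 1)
    (φ : ℝ × ℝ → ℝ)
    (hφ : φ = fun p =>
      4 * Real.arctan (v * Real.sinh (p.1 / Real.sqrt (1 - v^2))
        / Real.cosh (v * p.2 / Real.sqrt (1 - v^2)))) :
    ∀ X t : ℝ,
      fderiv ℝ (fun p => fderiv ℝ φ p (0, 1)) (X, t) (0, 1)
        - fderiv ℝ (fun p => fderiv ℝ φ p (1, 0)) (X, t) (1, 0)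
        + Real.sin (φ (X, t)) = 0 := by
  intro X t
  set s := Real.sqrt (1 - v ^ 2) with hs
  have hs0 : 0 < s := Real.sqrt_pos.2 (by nlinarith)
  have hs2 : s ^ 2 = 1 - v ^ 2 := Real.sq_sqrt (by nlinarith)
  have hc (y : ℝ) : Real.cosh (v * y / s) ≠ 0 := (Real.cosh_pos _).ne'
  have hD (x y : ℝ) : Real.cosh (v * y / s) ^ 2 + v ^ 2 * Real.sinh (x / s) ^ 2 ≠ 0 := by
    have := Real.cosh_pos (v * y / s)
    positivity
  have hD' (x y : ℝ) : 1 + (v * Real.sinh (x / s) / Real.cosh (v * y / s)) ^ 2 ≠ 0 := by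
    positivity
  have hdiff : Differentiable ℝ φ := by
    rw [hφ]
    intro p
    have := hc p.2
    refine (DifferentiableAt.arctan ?_).const_mul 4
    fun_prop (disch := assumption)
  have hX : (fun p => fderiv ℝ φ p (1, 0)) = fun p : ℝ × ℝ =>
      4 * v / s * (Real.cosh (p.1 / s) * Real.cosh (v * p.2 / s) /
        (Real.cosh (v * p.2 / s) ^ 2 + v ^ 2 * Real.sinh (p.1 / s) ^ 2)) := by
    ext ⟨x, y⟩
    refine fderiv_apply_one_zero (hdiff _) ?_
    rw [hφ]
    refine (((((hasDerivAt_sinh_div s x).const_mul v).div_const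
      (Real.cosh (v * y / s))).arctan).const_mul 4).congr_deriv ?_
    have := hc y
    have := hD x y
    have := hD' x y
    field_simp
  have hT : (fun p => fderiv ℝ φ p (0, 1)) = fun p : ℝ × ℝ =>
      -(4 * v ^ 2 / s) * (Real.sinh (p.1 / s) * Real.sinh (v * p.2 / s) /
        (Real.cosh (v * p.2 / s) ^ 2 + v ^ 2 * Real.sinh (p.1 / s) ^ 2)) := by
    ext ⟨x, y⟩
    refine fderiv_apply_zero_one (hdiff _) ?_
    rw [hφ]
    refine ((((hasDerivAt_const y (v * Real.sinh (x / s))).fun_div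
      (hasDerivAt_cosh_mul_div v s y) (hc y)).arctan).const_mul 4).congr_deriv ?_
    have := hc y
    have := hD x y
    have := hD' x y
    field_simp
    ring
  rw [hX, hT]
  have hXX := fderiv_apply_one_zero (X := X) (t := t) (f := fun p : ℝ × ℝ =>
      4 * v / s * (Real.cosh (p.1 / s) * Real.cosh (v * p.2 / s) /
        (Real.cosh (v * p.2 / s) ^ 2 + v ^ 2 * Real.sinh (p.1 / s) ^ 2)))
    (by
      have := hD X t
      fun_prop (disch := assumption))
    ((((hasDerivAt_cosh_div s X).mul_const (Real.cosh (v * t / s))).fun_div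
        ((((hasDerivAt_sinh_div s X).fun_pow 2).const_mul (v ^ 2)).const_add _)
        (hD X t)).const_mul (4 * v / s))
  have hTT := fderiv_apply_zero_one (X := X) (t := t) (f := fun p : ℝ × ℝ =>
      -(4 * v ^ 2 / s) * (Real.sinh (p.1 / s) * Real.sinh (v * p.2 / s) /
        (Real.cosh (v * p.2 / s) ^ 2 + v ^ 2 * Real.sinh (p.1 / s) ^ 2)))
    (by
      have := hD X t
      fun_prop (disch := assumption))
    ((((hasDerivAt_sinh_mul_div v s t).const_mul (Real.sinh (X / s))).fun_div
        (((hasDerivAt_cosh_mul_div v s t).fun_pow 2).add_const (v ^ 2 * Real.sinh (X / s) ^ 2))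
        (hD X t)).const_mul (-(4 * v ^ 2 / s)))
  rw [hXX, hTT, hφ, sin_four_mul_arctan]
  have hc0 := hc t
  have hD0 := hD X t
  have hD1 := hD' X t
  have hC := Real.cosh_sq (X / s)
  have hd := Real.sinh_sq (v * t / s)
  generalize Real.cosh (v * t / s) = c at *
  generalize Real.sinh (v * t / s) = d at *
  generalize Real.cosh (X / s) = C at *
  generalize Real.sinh (X / s) = S at *
  have hsin : 4 * (v * S / c) * (1 - (v * S / c) ^ 2) / (1 + (v * S / c) ^ 2) ^ 2 =
      4 * v * S * c * (c ^ 2 - v ^ 2 * S ^ 2) / (c ^ 2 + v ^ 2 * S ^ 2) ^ 2 := by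
    field_simp
  rw [hsin]
  field_simp
  rw [hC, hd, hs2]
  push_cast
  ring
end

section
/- Let v ∈ ℝ with 0 < v < 1 and let φ(X, t) = 4 · arctan( v · sinh( X/√(1 − v²) ) / cosh( v·t/√(1 − v²) ) ) be the two-soliton solution of the Sine-Gordon equation. Then for every t ∈ ℝ, the total energy integral converges and equals ∫_{−∞}^{∞} [ (1/2)(∂φ/∂t(X,t))² + (1/2)(∂φ/∂X(X,t))² + (1 − cos φ(X,t)) ] dX = 16/√(1 − v²). -/
open Real Filter Topology MeasureTheory

theorem integrable_of_hasDerivAt_of_nonneg {F f : ℝ → ℝ} {a b : ℝ}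
    (hderiv : ∀ x, HasDerivAt F (f x) x) (hf : ∀ x, 0 ≤ f x)
    (hbot : Tendsto F atBot (𝓝 a)) (htop : Tendsto F atTop (𝓝 b)) : Integrable f := by
  have hint (x y : ℝ) : IntegrableOn f (Set.Ioc x y) :=
    intervalIntegral.integrableOn_deriv_of_nonneg
      (fun z _ => (hderiv z).continuousAt.continuousWithinAt) (fun z _ => hderiv z)
      (fun z _ => hf z)
  refine integrable_of_intervalIntegral_norm_tendsto (a := fun x : ℝ => -x) (b := id) (l := atTop)
    (b - a) (fun i => hint _ _) tendsto_neg_atTop_atBot tendsto_id ?_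
  refine (htop.sub (hbot.comp tendsto_neg_atTop_atBot)).congr fun x => ?_
  simp only [norm_of_nonneg (hf _)]
  exact (intervalIntegral.integral_eq_sub_of_hasDerivAt (fun z _ => hderiv z)
    ⟨hint _ _, hint _ _⟩).symm

theorem tendsto_sinh_mul_cosh_div_atTop {v : ℝ} (hv : v ≠ 0) (C : ℝ) :
    Tendsto (fun x => sinh x * cosh x / (C ^ 2 + v ^ 2 * sinh x ^ 2)) atTop (𝓝 (1 / v ^ 2)) := by
  have hinv : Tendsto (fun x => (sinh x)⁻¹) atTop (𝓝 0) :=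
    tendsto_inv_atTop_zero.comp sinhOrderIso.tendsto_atTop
  have hlim : Tendsto (fun y : ℝ => √(1 + y ^ 2) / (C ^ 2 * y ^ 2 + v ^ 2)) (𝓝 0)
      (𝓝 (1 / v ^ 2)) := by
    have hcont : ContinuousAt (fun y : ℝ => √(1 + y ^ 2) / (C ^ 2 * y ^ 2 + v ^ 2)) 0 := by
      refine ContinuousAt.div (by fun_prop) (by fun_prop) (by simpa using hv)
    simpa [ContinuousAt] using hcont
  refine (hlim.comp hinv).congr' ?_
  filter_upwards [eventually_gt_atTop 0] with x hx
  have hs : 0 < sinh x := sinh_pos_iff.2 hx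
  have hroot : √(1 + (sinh x)⁻¹ ^ 2) = cosh x / sinh x := by
    rw [sqrt_eq_iff_mul_self_eq_of_pos (div_pos (cosh_pos x) hs)]
    field_simp
    linarith [cosh_sq x]
  have : 0 < v ^ 2 := by positivity
  simp only [Function.comp_apply, hroot]
  field_simp

theorem tendsto_sinh_mul_cosh_div_atBot {v : ℝ} (hv : v ≠ 0) (C : ℝ) :
    Tendsto (fun x => sinh x * cosh x / (C ^ 2 + v ^ 2 * sinh x ^ 2)) atBot
      (𝓝 (-(1 / v ^ 2))) := by
  refine ((tendsto_sinh_mul_cosh_div_atTop hv C).comp tendsto_neg_atBot_atTop).neg.congr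
    fun x => ?_
  simp only [Function.comp_apply, sinh_neg, cosh_neg]
  ring

theorem one_sub_cos_four_mul_arctan (y : ℝ) :
    1 - cos (4 * arctan y) = 8 * y ^ 2 / (1 + y ^ 2) ^ 2 := by
  have hpos : (1 + y ^ 2) ≠ 0 := by positivity
  rw [show 4 * arctan y = 2 * (2 * arctan y) by ring, cos_two_mul (2 * arctan y), cos_two_mul,
    cos_sq_arctan]
  field_simp
  ring

theorem hasDerivAt_sinh_mul_cosh_div {v C : ℝ} (hC : C ≠ 0) (x : ℝ) :
    HasDerivAt (fun x => sinh x * cosh x / (C ^ 2 + v ^ 2 * sinh x ^ 2))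
      ((C ^ 2 + 2 * C ^ 2 * sinh x ^ 2 - v ^ 2 * sinh x ^ 2) /
        (C ^ 2 + v ^ 2 * sinh x ^ 2) ^ 2) x := by
  have hQ : C ^ 2 + v ^ 2 * sinh x ^ 2 ≠ 0 := by positivity
  refine (((hasDerivAt_sinh x).mul (hasDerivAt_cosh x)).div
    ((((hasDerivAt_sinh x).pow 2).const_mul (v ^ 2)).const_add (C ^ 2)) hQ).congr_deriv ?_
  congr 1
  simp only [Pi.mul_apply, Pi.pow_apply]
  push_cast
  linear_combination (C ^ 2 - v ^ 2 * sinh x ^ 2) * cosh_sq x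

/-- The Sine-Gordon two-soliton solution, with arguments `(X, t)`. -/
noncomputable def twoSoliton (v : ℝ) (p : ℝ × ℝ) : ℝ :=
  4 * arctan (v * sinh (p.1 / √(1 - v ^ 2)) / cosh (v * p.2 / √(1 - v ^ 2)))

theorem differentiable_twoSoliton (v : ℝ) : Differentiable ℝ (twoSoliton v) := by
  have hC (p : ℝ × ℝ) : cosh (v * p.2 / √(1 - v ^ 2)) ≠ 0 := (cosh_pos _).ne'
  unfold twoSoliton
  refine Differentiable.const_mul (Differentiable.arctan ?_) 4
  simp only [div_eq_mul_inv] at hC ⊢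
  fun_prop (disch := exact hC)

theorem fderiv_twoSoliton_space (v X t : ℝ) :
    fderiv ℝ (twoSoliton v) (X, t) (1, 0) =
      4 * v * cosh (X / √(1 - v ^ 2)) * cosh (v * t / √(1 - v ^ 2)) /
        (√(1 - v ^ 2) * (cosh (v * t / √(1 - v ^ 2)) ^ 2 +
          v ^ 2 * sinh (X / √(1 - v ^ 2)) ^ 2)) := by
  have hline : HasDerivAt (fun X : ℝ => (X, t)) ((1 : ℝ), (0 : ℝ)) X :=
    (hasDerivAt_id X).prodMk (hasDerivAt_const X t)
  have hpartial := ((differentiable_twoSoliton v (X, t)).hasFDerivAt).comp_hasDerivAt X hline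
  refine hpartial.unique (HasDerivAt.congr_deriv (((((hasDerivAt_id X).div_const
    (√(1 - v ^ 2))).sinh.const_mul v).div_const
      (cosh (v * t / √(1 - v ^ 2)))).arctan.const_mul 4) ?_)
  have hC := cosh_pos (v * t / √(1 - v ^ 2))
  simp only [id]
  field_simp

theorem fderiv_twoSoliton_time (v X t : ℝ) :
    fderiv ℝ (twoSoliton v) (X, t) (0, 1) =
      -(4 * v ^ 2 * sinh (X / √(1 - v ^ 2)) * sinh (v * t / √(1 - v ^ 2))) /
        (√(1 - v ^ 2) * (cosh (v * t / √(1 - v ^ 2)) ^ 2 +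
          v ^ 2 * sinh (X / √(1 - v ^ 2)) ^ 2)) := by
  have hline : HasDerivAt (fun t : ℝ => (X, t)) ((0 : ℝ), (1 : ℝ)) t :=
    (hasDerivAt_const t X).prodMk (hasDerivAt_id t)
  have hC := cosh_pos (v * t / √(1 - v ^ 2))
  have hpartial := ((differentiable_twoSoliton v (X, t)).hasFDerivAt).comp_hasDerivAt t hline
  refine hpartial.unique (HasDerivAt.congr_deriv (((hasDerivAt_const t
    (v * sinh (X / √(1 - v ^ 2)))).div
      ((((hasDerivAt_id t).const_mul v).div_const (√(1 - v ^ 2))).cosh)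
        hC.ne').arctan.const_mul 4) ?_)
  have hQ : 0 < cosh (v * t / √(1 - v ^ 2)) ^ 2 + v ^ 2 * sinh (X / √(1 - v ^ 2)) ^ 2 := by
    positivity
  have hden : 1 + (v * sinh (X / √(1 - v ^ 2)) / cosh (v * t / √(1 - v ^ 2))) ^ 2 =
      (cosh (v * t / √(1 - v ^ 2)) ^ 2 + v ^ 2 * sinh (X / √(1 - v ^ 2)) ^ 2) /
        cosh (v * t / √(1 - v ^ 2)) ^ 2 := by
    field_simp
  simp only [id, Pi.div_apply]
  rw [hden]
  field_simp
  ring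

theorem twoSoliton_energy_density {v : ℝ} (hv : v ^ 2 < 1) (X t : ℝ) :
    (1/2) * (fderiv ℝ (twoSoliton v) (X, t) (0, 1)) ^ 2
        + (1/2) * (fderiv ℝ (twoSoliton v) (X, t) (1, 0)) ^ 2
        + (1 - cos (twoSoliton v (X, t))) =
      8 * v ^ 2 / √(1 - v ^ 2) *
        ((cosh (v * t / √(1 - v ^ 2)) ^ 2
            + 2 * cosh (v * t / √(1 - v ^ 2)) ^ 2 * sinh (X / √(1 - v ^ 2)) ^ 2
            - v ^ 2 * sinh (X / √(1 - v ^ 2)) ^ 2) /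
          (cosh (v * t / √(1 - v ^ 2)) ^ 2 + v ^ 2 * sinh (X / √(1 - v ^ 2)) ^ 2) ^ 2 *
        (1 / √(1 - v ^ 2))) := by
  rw [fderiv_twoSoliton_space, fderiv_twoSoliton_time, twoSoliton, one_sub_cos_four_mul_arctan]
  have hs : 0 < √(1 - v ^ 2) := sqrt_pos.2 (by linarith)
  have hs2 : √(1 - v ^ 2) ^ 2 = 1 - v ^ 2 := sq_sqrt (by linarith)
  dsimp only
  have hc := cosh_sq (X / √(1 - v ^ 2))
  have hD := cosh_sq (v * t / √(1 - v ^ 2))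
  have hCpos := cosh_pos (v * t / √(1 - v ^ 2))
  generalize sinh (X / √(1 - v ^ 2)) = S at *
  generalize cosh (X / √(1 - v ^ 2)) = c at *
  generalize cosh (v * t / √(1 - v ^ 2)) = C at *
  generalize sinh (v * t / √(1 - v ^ 2)) = D at *
  generalize √(1 - v ^ 2) = s at *
  have hD' : D ^ 2 = C ^ 2 - 1 := by linarith
  have hratio : 8 * (v * S / C) ^ 2 / (1 + (v * S / C) ^ 2) ^ 2 =
      8 * v ^ 2 * S ^ 2 * C ^ 2 / (C ^ 2 + v ^ 2 * S ^ 2) ^ 2 := by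
    field_simp
  have hQ : 0 < C ^ 2 + v ^ 2 * S ^ 2 := by positivity
  rw [hratio, div_pow, div_pow, mul_pow s, neg_sq, mul_pow, mul_pow, mul_pow, mul_pow, mul_pow, hc,
    hD']
  field_simp
  rw [hs2]
  ring


/-- for the two-soliton solution
`φ(X,t) = 4 arctan(v sinh(X/√(1 − v²)) / cosh(v t/√(1 − v²)))` with `0 < v < 1`,
at every time `t` the Sine-Gordon energy density
`(1/2) φ_t² + (1/2) φ_X² + (1 − cos φ)` is integrable over `X ∈ ℝ` and its
integral equals `16/√(1 − v²)`. The argument order is `(X, t)`; `∂/∂X` is the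
directional derivative along `(1,0)` and `∂/∂t` along `(0,1)`. -/
theorem stmt19 (v : ℝ) (hv0 : 0 < v) (hv1 : v < 1)
    (φ : ℝ × ℝ → ℝ)
    (hφ : φ = fun p =>
      4 * Real.arctan (v * Real.sinh (p.1 / Real.sqrt (1 - v^2))
        / Real.cosh (v * p.2 / Real.sqrt (1 - v^2)))) :
    ∀ t : ℝ,
      MeasureTheory.Integrable (fun X : ℝ =>
        (1/2) * (fderiv ℝ φ (X, t) (0, 1))^2
          + (1/2) * (fderiv ℝ φ (X, t) (1, 0))^2
          + (1 - Real.cos (φ (X, t)))) ∧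
      ∫ X : ℝ,
          ((1/2) * (fderiv ℝ φ (X, t) (0, 1))^2
            + (1/2) * (fderiv ℝ φ (X, t) (1, 0))^2
            + (1 - Real.cos (φ (X, t))))
        = 16 / Real.sqrt (1 - v^2) := by
  intro t
  obtain rfl : φ = twoSoliton v := hφ
  have hv : v ^ 2 < 1 := by nlinarith
  have hs : 0 < √(1 - v ^ 2) := sqrt_pos.2 (by linarith)
  have hnonneg (X : ℝ) : 0 ≤ (1/2) * (fderiv ℝ (twoSoliton v) (X, t) (0, 1)) ^ 2
      + (1/2) * (fderiv ℝ (twoSoliton v) (X, t) (1, 0)) ^ 2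
      + (1 - cos (twoSoliton v (X, t))) := by
    have := cos_le_one (twoSoliton v (X, t))
    have : 0 ≤ 1 - cos (twoSoliton v (X, t)) := by linarith
    positivity
  have hderiv (X : ℝ) := ((((hasDerivAt_sinh_mul_cosh_div (v := v)
    (cosh_pos (v * t / √(1 - v ^ 2))).ne' (X / √(1 - v ^ 2))).comp X
      ((hasDerivAt_id X).div_const (√(1 - v ^ 2)))).const_mul
        (8 * v ^ 2 / √(1 - v ^ 2))).congr_deriv (twoSoliton_energy_density hv X t).symm)
  have htop := ((tendsto_sinh_mul_cosh_div_atTop hv0.ne' (cosh (v * t / √(1 - v ^ 2)))).comp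
    (tendsto_id.atTop_div_const hs)).const_mul (8 * v ^ 2 / √(1 - v ^ 2))
  have hbot := ((tendsto_sinh_mul_cosh_div_atBot hv0.ne' (cosh (v * t / √(1 - v ^ 2)))).comp
    (tendsto_id.atBot_div_const hs)).const_mul (8 * v ^ 2 / √(1 - v ^ 2))
  have hint := integrable_of_hasDerivAt_of_nonneg hderiv hnonneg hbot htop
  refine ⟨hint, (integral_of_hasDerivAt_of_tendsto hderiv hint hbot htop).trans ?_⟩
  field_simp
  ring
end
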